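/- arXiv:math/0311364 — 2 statements merged into one kernel-verified Lean document; each statement's English description precedes it below -/
import Mathlib

section
/- For all integers i, j ≥ 1, the following identity holds: (2i)!·(2j)!·(i+j-1)! / (4·(i!)^2·(j!)^2·(2i-j)!·(2j-i)!) = Σ_k k·(2k+i-1)!·(2k+j-1)! / ((i-k)!·(i+k)!·(j-k)!·(j+k)!·(2k-i)!·(2k-j)!), where the sum runs over integers k with max(⌈i/2⌉, ⌈j/2⌉) ≤ k ≤ min(i,j), and where both sides are interpreted as 0 when i > 2j or j > 2i (i.e., terms with any negative factorial argument are omitted). -/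
open Nat Finset

/-- Reciprocal factorial on the integers, zero at negative arguments. -/
def invFac (n : ℤ) : ℚ := if n < 0 then 0 else 1 / ((n.toNat)! : ℚ)

theorem invFac_neg {n : ℤ} (h : n < 0) : invFac n = 0 := by simp [invFac, h]

theorem invFac_nat (n : ℕ) : invFac (n : ℤ) = 1 / (n ! : ℚ) := by simp [invFac]

theorem invFac_of_eq {n : ℤ} {m : ℕ} (h : n = m) : invFac n = 1 / (m ! : ℚ) := by
  rw [h, invFac_nat]

theorem invFac_pred {m n : ℤ} (h : m = n + 1) : invFac n = (m : ℚ) * invFac m := by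
  subst h
  rcases lt_trichotomy n (-1) with h | h | h
  · rw [invFac_neg (by omega), invFac_neg (by omega)]; simp
  · subst h; simp [invFac]
  · obtain ⟨k, rfl⟩ := Int.eq_ofNat_of_zero_le (show 0 ≤ n by omega)
    rw [invFac_nat, invFac_of_eq (m := k + 1) (by push_cast; rfl), Nat.factorial_succ]
    have : (k ! : ℚ) ≠ 0 := by exact_mod_cast Nat.factorial_ne_zero k
    have : (k + 1 : ℚ) ≠ 0 := by positivity
    push_cast
    field_simp

/-- The summand, with `i = a + 1` and `j = b + 1`. -/
def summand (a b k : ℕ) : ℚ :=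
  (k : ℚ) * ((2 * k + a)! : ℚ) * ((2 * k + b)! : ℚ) * invFac (a + 1 - k) * invFac (a + 1 + k)
    * invFac (b + 1 - k) * invFac (b + 1 + k) * invFac (2 * k - a - 1) * invFac (2 * k - b - 1)

/-- The telescoping certificate. -/
def certif (a b k : ℕ) : ℚ :=
  ((2 * k + a)! : ℚ) * ((2 * k + b)! : ℚ) * invFac (a + 2 - k) * invFac (a + 1 + k)
    * invFac (b + 1 - k) * invFac (b + k) * invFac (2 * k - a - 3) * invFac (2 * k - b - 3)

/-- The left-hand side. -/
def closedForm (a b : ℕ) : ℚ :=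
  ((2 * (a + 1))! : ℚ) * ((2 * (b + 1))! : ℚ) * ((a + b + 1)! : ℚ) /
    (4 * ((a + 1)! : ℚ) ^ 2 * ((b + 1)! : ℚ) ^ 2) * invFac (2 * a + 1 - b) * invFac (2 * b + 1 - a)

theorem certif_step (a b k : ℕ) :
    2 * ((a : ℚ) + b + 3) *
      (((a : ℚ) + 2) * (2 * a + 3 - b) * (2 * a + 2 - b) * summand (a + 1) b k
        - 2 * (2 * (a : ℚ) + 3) * (a + b + 2) * (2 * b + 1 - a) * summand a b k)
      = -(3 * (a : ℚ) + 5) * (certif a b (k + 1) - certif a b k) := by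
  unfold summand certif
  rw [show 2 * k + (a + 1) = (2 * k + a) + 1 by ring,
    show 2 * (k + 1) + a = ((2 * k + a) + 1) + 1 by ring,
    show 2 * (k + 1) + b = ((2 * k + b) + 1) + 1 by ring]
  simp only [Nat.factorial_succ]
  push_cast
  rw [show ((a : ℤ) + 1 + 1 - k) = a + 2 - k by ring, show ((a : ℤ) + 1 + 1 + k) = a + 2 + k by ring,
    show ((a : ℤ) + 2 - (k + 1)) = a + 1 - k by ring, show ((a : ℤ) + 1 + (k + 1)) = a + 2 + k by ring,
    show ((b : ℤ) + 1 - (k + 1)) = b - k by ring, show ((b : ℤ) + (k + 1)) = b + 1 + k by ring,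
    show (2 * ((k : ℤ) + 1) - a - 3) = 2 * k - a - 1 by ring,
    show (2 * ((k : ℤ) + 1) - b - 3) = 2 * k - b - 1 by ring,
    show (2 * (k : ℤ) - (a + 1) - 1) = 2 * k - a - 2 by ring,
    invFac_pred (n := (a : ℤ) + 1 - k) (m := a + 2 - k) (by ring),
    invFac_pred (n := (a : ℤ) + 1 + k) (m := a + 2 + k) (by ring),
    invFac_pred (n := (b : ℤ) - k) (m := b + 1 - k) (by ring),
    invFac_pred (n := (b : ℤ) + k) (m := b + 1 + k) (by ring),
    invFac_pred (n := 2 * (k : ℤ) - a - 3) (m := 2 * k - a - 2) (by ring),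
    invFac_pred (n := 2 * (k : ℤ) - a - 2) (m := 2 * k - a - 1) (by ring),
    invFac_pred (n := 2 * (k : ℤ) - b - 3) (m := 2 * k - b - 2) (by ring),
    invFac_pred (n := 2 * (k : ℤ) - b - 2) (m := 2 * k - b - 1) (by ring)]
  push_cast
  ring

theorem sum_step (a b : ℕ) :
    ((a : ℚ) + 2) * (2 * a + 3 - b) * (2 * a + 2 - b) * ∑ k ∈ range (b + 2), summand (a + 1) b k
      = 2 * (2 * (a : ℚ) + 3) * (a + b + 2) * (2 * b + 1 - a)
        * ∑ k ∈ range (b + 2), summand a b k := by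
  have h := Finset.sum_congr (rfl : range (b + 2) = range (b + 2))
    (fun k _ => certif_step a b k)
  rw [← mul_sum, ← mul_sum, sum_range_sub, sum_sub_distrib, ← mul_sum, ← mul_sum] at h
  have h0 : certif a b 0 = 0 := by
    unfold certif; rw [invFac_neg (n := 2 * ((0 : ℕ) : ℤ) - a - 3) (by push_cast; omega)]; simp
  have h1 : certif a b (b + 2) = 0 := by
    unfold certif; rw [invFac_neg (n := (b : ℤ) + 1 - (b + 2 : ℕ)) (by push_cast; omega)]; simp
  rw [h0, h1, sub_zero, mul_zero] at h
  have hne : 2 * ((a : ℚ) + b + 3) ≠ 0 := by positivity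
  exact sub_eq_zero.mp ((mul_eq_zero.mp h).resolve_left hne)

theorem closed_step (a b : ℕ) :
    ((a : ℚ) + 2) * (2 * a + 3 - b) * (2 * a + 2 - b) * closedForm (a + 1) b
      = 2 * (2 * (a : ℚ) + 3) * (a + b + 2) * (2 * b + 1 - a) * closedForm a b := by
  unfold closedForm
  rw [show 2 * (a + 1 + 1) = 2 * (a + 1) + 1 + 1 by ring,
    show a + 1 + b + 1 = (a + b + 1) + 1 by ring,
    Nat.factorial_succ (2 * (a + 1) + 1), Nat.factorial_succ (2 * (a + 1)),
    Nat.factorial_succ (a + b + 1), Nat.factorial_succ (a + 1)]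
  push_cast
  rw [show (2 * ((a : ℤ) + 1) + 1 - b) = 2 * a + 3 - b by ring,
    show (2 * (b : ℤ) + 1 - (a + 1)) = 2 * b - a by ring,
    invFac_pred (n := 2 * (a : ℤ) + 1 - b) (m := 2 * a + 2 - b) (by ring),
    invFac_pred (n := 2 * (a : ℤ) + 2 - b) (m := 2 * a + 3 - b) (by ring),
    invFac_pred (n := 2 * (b : ℤ) - a) (m := 2 * b + 1 - a) (by ring)]
  have h1 : ((a + 1)! : ℚ) ≠ 0 := by exact_mod_cast Nat.factorial_ne_zero _
  have h2 : ((b + 1)! : ℚ) ≠ 0 := by exact_mod_cast Nat.factorial_ne_zero _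
  have h3 : ((a : ℚ) + 1 + 1) ≠ 0 := by positivity
  push_cast
  field_simp
  ring

theorem sum_base (a b : ℕ) (h : b = 2 * a ∨ b = 2 * a + 1) :
    ∑ k ∈ range (b + 2), summand a b k = closedForm a b := by
  rw [Finset.sum_eq_single (a + 1)]
  · unfold summand closedForm
    rw [show 2 * (a + 1) = 2 * a + 1 + 1 by ring, show 2 * (b + 1) = 2 * b + 1 + 1 by ring]
    have f0 : (a ! : ℚ) ≠ 0 := by exact_mod_cast Nat.factorial_ne_zero _
    have f1 : ((2 * a)! : ℚ) ≠ 0 := by exact_mod_cast Nat.factorial_ne_zero _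
    have f2 : ((3 * a)! : ℚ) ≠ 0 := by exact_mod_cast Nat.factorial_ne_zero _
    have f3 : ((4 * a)! : ℚ) ≠ 0 := by exact_mod_cast Nat.factorial_ne_zero _
    rcases h with rfl | rfl
    · rw [invFac_of_eq (n := (a : ℤ) + 1 - (a + 1 : ℕ)) (m := 0) (by push_cast; ring),
        invFac_of_eq (n := (a : ℤ) + 1 + (a + 1 : ℕ)) (m := 2 * a + 1 + 1) (by push_cast; ring),
        invFac_of_eq (n := ((2 * a : ℕ) : ℤ) + 1 - (a + 1 : ℕ)) (m := a) (by push_cast; ring),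
        invFac_of_eq (n := ((2 * a : ℕ) : ℤ) + 1 + (a + 1 : ℕ)) (m := 3 * a + 1 + 1)
          (by push_cast; ring),
        invFac_of_eq (n := 2 * ((a + 1 : ℕ) : ℤ) - a - 1) (m := a + 1) (by push_cast; ring),
        invFac_of_eq (n := 2 * ((a + 1 : ℕ) : ℤ) - (2 * a : ℕ) - 1) (m := 1) (by push_cast; ring),
        invFac_of_eq (n := 2 * (a : ℤ) + 1 - (2 * a : ℕ)) (m := 1) (by push_cast; ring),
        invFac_of_eq (n := 2 * ((2 * a : ℕ) : ℤ) + 1 - a) (m := 3 * a + 1) (by push_cast; ring),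
        show 2 * a + 1 + 1 + a = 3 * a + 1 + 1 by ring,
        show 2 * a + 1 + 1 + 2 * a = 4 * a + 1 + 1 by ring,
        show 2 * (2 * a) + 1 + 1 = 4 * a + 1 + 1 by ring,
        show a + 2 * a + 1 = 3 * a + 1 by ring]
      simp only [Nat.factorial_succ, Nat.factorial_zero]
      push_cast
      field_simp
      ring
    · rw [invFac_of_eq (n := (a : ℤ) + 1 - (a + 1 : ℕ)) (m := 0) (by push_cast; ring),
        invFac_of_eq (n := (a : ℤ) + 1 + (a + 1 : ℕ)) (m := 2 * a + 1 + 1) (by push_cast; ring),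
        invFac_of_eq (n := ((2 * a + 1 : ℕ) : ℤ) + 1 - (a + 1 : ℕ)) (m := a + 1)
          (by push_cast; ring),
        invFac_of_eq (n := ((2 * a + 1 : ℕ) : ℤ) + 1 + (a + 1 : ℕ)) (m := 3 * a + 1 + 1 + 1)
          (by push_cast; ring),
        invFac_of_eq (n := 2 * ((a + 1 : ℕ) : ℤ) - a - 1) (m := a + 1) (by push_cast; ring),
        invFac_of_eq (n := 2 * ((a + 1 : ℕ) : ℤ) - (2 * a + 1 : ℕ) - 1) (m := 0)
          (by push_cast; ring),
        invFac_of_eq (n := 2 * (a : ℤ) + 1 - (2 * a + 1 : ℕ)) (m := 0) (by push_cast; ring),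
        invFac_of_eq (n := 2 * ((2 * a + 1 : ℕ) : ℤ) + 1 - a) (m := 3 * a + 1 + 1 + 1)
          (by push_cast; ring),
        show 2 * a + 1 + 1 + a = 3 * a + 1 + 1 by ring,
        show 2 * a + 1 + 1 + (2 * a + 1) = 4 * a + 1 + 1 + 1 by ring,
        show 2 * (2 * a + 1) + 1 + 1 = 4 * a + 1 + 1 + 1 + 1 by ring,
        show a + (2 * a + 1) + 1 = 3 * a + 1 + 1 by ring]
      simp only [Nat.factorial_succ, Nat.factorial_zero]
      push_cast
      field_simp
      ring
  · intro k _ hk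
    unfold summand
    rcases lt_or_gt_of_ne hk with hk | hk
    · rw [invFac_neg (n := 2 * (k : ℤ) - b - 1) (by omega)]; simp
    · rw [invFac_neg (n := (a : ℤ) + 1 - k) (by omega)]; simp
  · intro hk
    exact absurd (mem_range.mpr (by omega)) hk

theorem sum_closed (b a : ℕ) (h : (b + 1) / 2 ≤ a ∨ b = 2 * a + 1) :
    ∑ k ∈ range (b + 2), summand a b k = closedForm a b := by
  have hb : b / 2 ≤ a := by omega
  clear h
  induction a, hb using Nat.le_induction with
  | base => exact sum_base _ _ (by omega)
  | succ a ha ih =>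
    have h1 := sum_step a b
    rw [ih, ← closed_step] at h1
    have hab : (b : ℚ) ≤ 2 * a + 1 := by exact_mod_cast (show b ≤ 2 * a + 1 by omega)
    refine mul_left_cancel₀ ?_ h1
    have e1 : (0 : ℚ) < 2 * a + 3 - b := by linarith
    have e2 : (0 : ℚ) < 2 * a + 2 - b := by linarith
    positivity

open Nat Finset in
theorem dougall_specialization (i j : ℕ) (hi : 1 ≤ i) (hj : 1 ≤ j) :
    (if i ≤ 2 * j ∧ j ≤ 2 * i then
        (((2 * i)! : ℚ) * ((2 * j)! : ℚ) * ((i + j - 1)! : ℚ)) /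
          (4 * (i ! : ℚ) ^ 2 * (j ! : ℚ) ^ 2 * ((2 * i - j)! : ℚ) * ((2 * j - i)! : ℚ))
      else 0) =
    ∑ k ∈ Finset.Icc (max ((i + 1) / 2) ((j + 1) / 2)) (min i j),
      ((k : ℚ) * ((2 * k + i - 1)! : ℚ) * ((2 * k + j - 1)! : ℚ)) /
        (((i - k)! : ℚ) * ((i + k)! : ℚ) * ((j - k)! : ℚ) * ((j + k)! : ℚ) *
          ((2 * k - i)! : ℚ) * ((2 * k - j)! : ℚ)) := by
  split_ifs with h
  · obtain ⟨a, rfl⟩ : ∃ a, i = a + 1 := ⟨i - 1, by omega⟩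
    obtain ⟨b, rfl⟩ : ∃ b, j = b + 1 := ⟨j - 1, by omega⟩
    have key := sum_closed b a (by omega)
    have hL : closedForm a b = (((2 * (a + 1))! : ℚ) * ((2 * (b + 1))! : ℚ) *
        ((a + 1 + (b + 1) - 1)! : ℚ)) / (4 * ((a + 1)! : ℚ) ^ 2 * ((b + 1)! : ℚ) ^ 2 *
        ((2 * (a + 1) - (b + 1))! : ℚ) * ((2 * (b + 1) - (a + 1))! : ℚ)) := by
      unfold closedForm
      rw [invFac_of_eq (n := 2 * (a : ℤ) + 1 - b) (m := 2 * (a + 1) - (b + 1)) (by omega),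
        invFac_of_eq (n := 2 * (b : ℤ) + 1 - a) (m := 2 * (b + 1) - (a + 1)) (by omega),
        show a + 1 + (b + 1) - 1 = a + b + 1 by omega]
      simp only [div_eq_mul_inv, mul_inv]
      ring
    rw [← hL, ← key]
    symm
    refine (Finset.sum_congr rfl ?_).trans (Finset.sum_subset ?_ ?_)
    · intro k hk
      rw [Finset.mem_Icc] at hk
      unfold summand
      rw [invFac_of_eq (n := (a : ℤ) + 1 - k) (m := a + 1 - k) (by omega),
        invFac_of_eq (n := (a : ℤ) + 1 + k) (m := a + 1 + k) (by omega),
        invFac_of_eq (n := (b : ℤ) + 1 - k) (m := b + 1 - k) (by omega),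
        invFac_of_eq (n := (b : ℤ) + 1 + k) (m := b + 1 + k) (by omega),
        invFac_of_eq (n := 2 * (k : ℤ) - a - 1) (m := 2 * k - (a + 1)) (by omega),
        invFac_of_eq (n := 2 * (k : ℤ) - b - 1) (m := 2 * k - (b + 1)) (by omega),
        show 2 * k + (a + 1) - 1 = 2 * k + a by omega,
        show 2 * k + (b + 1) - 1 = 2 * k + b by omega]
      simp only [div_eq_mul_inv, mul_inv]
      ring
    · intro k hk
      rw [Finset.mem_Icc] at hk
      rw [Finset.mem_range]
      omega
    · intro k hk hk'
      rw [Finset.mem_Icc] at hk'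
      rw [Finset.mem_range] at hk
      unfold summand
      by_cases c1 : a + 1 < k
      · rw [invFac_neg (n := (a : ℤ) + 1 - k) (by omega)]; simp
      by_cases c2 : 2 * k < a + 1
      · rw [invFac_neg (n := 2 * (k : ℤ) - a - 1) (by omega)]; simp
      · rw [invFac_neg (n := 2 * (k : ℤ) - b - 1) (by omega)]; simp
  · rw [Finset.Icc_eq_empty (by omega), Finset.sum_empty]
end

section
/- Let g = 64·q·∏_{n≥1}(1+q^n)^{24} and j = E_4^3/Δ where E_4 = 1 + 240·Σ_{n≥1}σ_3(n)q^n and Δ = q·∏_{n≥1}(1-q^n)^{24}. Then j·g = 64·(4g+1)^3 as elements of ℚ[[q]], equivalently 64/j = g/(4g+1)^3 as formal Laurent series over ℚ. -/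
open PowerSeries Finset

/-- The Eisenstein series `E₄ = 1 + 240·Σ σ₃(n) qⁿ` over `ℚ`. -/
noncomputable def E4 : PowerSeries ℚ :=
  PowerSeries.mk fun n => if n = 0 then 1 else 240 * ∑ d ∈ n.divisors, (d : ℚ) ^ 3


/-- `a` converges on the open unit disc to `F`. -/
def JRep (a : PowerSeries ℂ) (F : ℂ → ℂ) : Prop :=
  ∀ q : ℂ, ‖q‖ < 1 → HasSum (fun n => coeff n a * q ^ n) (F q)

lemma JRep.add {a b : PowerSeries ℂ} {F G : ℂ → ℂ} (ha : JRep a F) (hb : JRep b G) :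
    JRep (a + b) (fun q => F q + G q) := by
  intro q hq
  simpa [add_mul] using (ha q hq).add (hb q hq)

lemma JRep.sub {a b : PowerSeries ℂ} {F G : ℂ → ℂ} (ha : JRep a F) (hb : JRep b G) :
    JRep (a - b) (fun q => F q - G q) := by
  intro q hq
  simpa [sub_mul] using (ha q hq).sub (hb q hq)

lemma JRep.const (c : ℂ) : JRep (C c) (fun _ => c) := by
  intro q hq
  have := hasSum_single (f := fun n => coeff n (C c) * q ^ n) 0
    (by intro n hn; simp [coeff_C, hn])
  simpa using this

lemma JRep.var : JRep X (fun q => q) := by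
  intro q hq
  have := hasSum_single (f := fun n => coeff n (X : PowerSeries ℂ) * q ^ n) 1
    (by intro n hn; simp [coeff_X, hn])
  simpa using this

lemma JRep.mul {a b : PowerSeries ℂ} {F G : ℂ → ℂ} (ha : JRep a F) (hb : JRep b G) :
    JRep (a * b) (fun q => F q * G q) := by
  intro q hq
  have h1 := (ha q hq).summable.norm
  have h2 := (hb q hq).summable.norm
  have h3 := tsum_mul_tsum_eq_tsum_sum_antidiagonal_of_summable_norm h1 h2
  have h4 := (summable_norm_sum_mul_antidiagonal_of_summable_norm h1 h2).of_norm
  rw [(ha q hq).tsum_eq, (hb q hq).tsum_eq] at h3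
  change HasSum _ (F q * G q)
  rw [h3]
  have he : (fun n => coeff n (a * b) * q ^ n) = fun n : ℕ => ∑ kl ∈ antidiagonal n,
      coeff kl.1 a * q ^ kl.1 * (coeff kl.2 b * q ^ kl.2) := by
    funext n
    rw [coeff_mul, Finset.sum_mul]
    refine Finset.sum_congr rfl fun p hp => ?_
    rw [← HasAntidiagonal.mem_antidiagonal.1 hp, pow_add]
    ring
  rw [he]
  exact h4.hasSum

lemma JRep.pow {a : PowerSeries ℂ} {F : ℂ → ℂ} (ha : JRep a F) (k : ℕ) :
    JRep (a ^ k) (fun q => F q ^ k) := by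
  induction k with
  | zero => simpa using JRep.const 1
  | succ k ih => simpa [pow_succ] using ih.mul ha

lemma JRep.prod {a : ℕ → PowerSeries ℂ} {F : ℕ → ℂ → ℂ} (ha : ∀ n, JRep (a n) (F n)) (k : ℕ) :
    JRep (∏ n ∈ range k, a n) (fun q => ∏ n ∈ range k, F n q) := by
  induction k with
  | zero => simpa using JRep.const 1
  | succ k ih => simpa [prod_range_succ] using ih.mul (ha k)

lemma JRep.hasFPowerSeries {a : PowerSeries ℂ} {F : ℂ → ℂ} (ha : JRep a F) :
    HasFPowerSeriesOnBall F (.ofScalars ℂ (fun n => coeff n a)) 0 1 := by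
  constructor
  · refine le_of_forall_lt_imp_le_of_dense fun r hr ↦ ?_
    lift r to NNReal using hr.ne_top
    apply FormalMultilinearSeries.le_radius_of_summable
    simpa [smul_eq_mul, norm_mul, mul_comm, mul_left_comm, mul_assoc] using
      (ha (r : ℂ) (by simpa using hr)).summable.norm
  · simp
  · intro y hy
    rw [← ENNReal.coe_one, Metric.eball_coe, NNReal.coe_one, mem_ball_zero_iff] at hy
    simpa [mul_comm] using ha y hy

lemma JRep.eq_zero {a : PowerSeries ℂ} {F : ℂ → ℂ} (ha : JRep a F)
    (h : ∀ q : ℂ, ‖q‖ < 1 → F q = 0) : a = 0 := by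
  have h1 := ha.hasFPowerSeries.hasFPowerSeriesAt
  have h2 : F =ᶠ[nhds 0] fun _ => 0 := by
    filter_upwards [Metric.ball_mem_nhds (0:ℂ) one_pos] with q hq
    exact h q (by simpa using hq)
  have h3 := (h1.congr h2).eq_zero
  have h4 := FormalMultilinearSeries.ofScalars_series_eq_zero (E := ℂ) |>.1 h3
  ext n
  simpa using congrFun h4 n

lemma JRep.coeff_eq {a : PowerSeries ℂ} {F : ℂ → ℂ} (ha : JRep a F) (n : ℕ) :
    coeff n a = (n.factorial : ℂ)⁻¹ * iteratedDeriv n F 0 := by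
  have := ha.hasFPowerSeries.hasFPowerSeriesAt.eq_formalMultilinearSeries
    ha.hasFPowerSeries.analyticAt.hasFPowerSeriesAt
  have h := congrArg (fun p => FormalMultilinearSeries.coeff p n) this
  simp only [FormalMultilinearSeries.coeff_ofScalars] at h
  rw [h]
  field_simp

lemma tendsto_iteratedDeriv_aux {F : ℕ → ℂ → ℂ} {f : ℂ → ℂ}
    (hF : TendstoLocallyUniformlyOn F f Filter.atTop (Metric.ball 0 1))
    (hd : ∀ n, DifferentiableOn ℂ (F n) (Metric.ball 0 1)) (k : ℕ) :
    TendstoLocallyUniformlyOn (fun n => iteratedDeriv k (F n)) (iteratedDeriv k f)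
      Filter.atTop (Metric.ball 0 1) ∧
    ∀ n, DifferentiableOn ℂ (iteratedDeriv k (F n)) (Metric.ball 0 1) := by
  induction k with
  | zero => simpa using ⟨hF, hd⟩
  | succ k ih =>
    simp only [iteratedDeriv_succ]
    exact ⟨ih.1.deriv (Filter.Eventually.of_forall ih.2) Metric.isOpen_ball,
      fun n => (ih.2 n).deriv Metric.isOpen_ball⟩

lemma JRep.limit {F : ℕ → ℂ → ℂ} {f : ℂ → ℂ} {a : ℕ → PowerSeries ℂ} {b : PowerSeries ℂ}
    (hF : TendstoLocallyUniformlyOn F f Filter.atTop (Metric.ball 0 1))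
    (ha : ∀ n, JRep (a n) (F n)) (hb : ∀ k, ∀ᶠ n in Filter.atTop, coeff k (a n) = coeff k b) :
    JRep b f := by
  have hd : ∀ n, DifferentiableOn ℂ (F n) (Metric.ball 0 1) := fun n => by
    have := (ha n).hasFPowerSeries.differentiableOn
    rwa [← ENNReal.coe_one, Metric.eball_coe, NNReal.coe_one] at this
  have hdf : DifferentiableOn ℂ f (Metric.ball 0 1) :=
    hF.differentiableOn (Filter.Eventually.of_forall hd) Metric.isOpen_ball
  have hc : ∀ k, coeff k b = (k.factorial : ℂ)⁻¹ * iteratedDeriv k f 0 := by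
    intro k
    have h1 := ((tendsto_iteratedDeriv_aux hF hd k).1.tendsto_at
      (Metric.mem_ball_self one_pos)).const_mul (k.factorial : ℂ)⁻¹
    refine tendsto_nhds_unique ?_ h1
    refine tendsto_const_nhds.congr' ?_
    filter_upwards [hb k] with n hn
    rw [← hn, (ha n).coeff_eq]
  intro q hq
  have := Complex.hasSum_taylorSeries_on_ball (r := 1) (c := 0) (f := f) (z := q)
    hdf (by simpa using hq)
  have he : (fun n => coeff n b * q ^ n) =
      fun n : ℕ => (n.factorial : ℂ)⁻¹ • (q - 0) ^ n • iteratedDeriv n f 0 := by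
    funext n
    rw [hc]; simp [mul_comm, mul_left_comm]
  rw [he]; exact this


lemma jprod_tendsto (ε : ℂ) (hε : ‖ε‖ = 1) :
    TendstoLocallyUniformlyOn (fun N q => ∏ n ∈ range N, (1 + ε * q ^ (n + 1)))
      (fun q => ∏' n : ℕ, (1 + ε * q ^ (n + 1))) Filter.atTop (Metric.ball (0 : ℂ) 1) := by
  refine HasProdLocallyUniformlyOn.tendstoLocallyUniformlyOn_finsetRange ?_
  apply hasProdLocallyUniformlyOn_of_forall_compact Metric.isOpen_ball
  intro K hK hcK
  rcases K.eq_empty_or_nonempty with hN | hN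
  · simpa [hasProdUniformlyOn_iff_tendstoUniformlyOn, hN] using tendstoUniformlyOn_empty
  · obtain ⟨q₀, hq₀, _, HB⟩ := hcK.exists_sSup_image_eq_and_ge hN
      (show ContinuousOn (fun q : ℂ ↦ ‖q‖) K by fun_prop)
    refine ((summable_nat_add_iff 1).mpr (summable_geometric_of_lt_one (norm_nonneg _)
      (by simpa [Metric.mem_ball, dist_zero_right] using hK hq₀))).hasProdUniformlyOn_nat_one_add
      hcK (.of_forall fun n x hx ↦ ?_) (fun _ ↦ by fun_prop)
    simpa [hε] using pow_le_pow_left₀ (norm_nonneg _) (HB x hx) (n + 1)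

lemma jprod_cont (ε : ℂ) (hε : ‖ε‖ = 1) :
    ContinuousOn (fun q => ∏' n : ℕ, (1 + ε * q ^ (n + 1))) (Metric.ball (0 : ℂ) 1) := by
  refine (jprod_tendsto ε hε).continuousOn (Filter.Frequently.of_forall fun N => ?_)
  fun_prop

lemma jpow_tendsto {F : ℕ → ℂ → ℂ} {f : ℂ → ℂ} {s : Set ℂ}
    (hF : TendstoLocallyUniformlyOn F f Filter.atTop s) (hf : ContinuousOn f s) (k : ℕ) :
    TendstoLocallyUniformlyOn (fun N q => F N q ^ k) (fun q => f q ^ k) Filter.atTop s := by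
  induction k with
  | zero =>
    simp only [pow_zero]
    intro u hu x hx
    exact ⟨_, self_mem_nhdsWithin, Filter.Eventually.of_forall fun _ _ _ => refl_mem_uniformity hu⟩
  | succ k ih =>
    simp only [pow_succ]
    exact ih.mul₀ hF (hf.pow k) hf

lemma jconst_tendsto (f : ℂ → ℂ) (s : Set ℂ) :
    TendstoLocallyUniformlyOn (fun _ : ℕ => f) f Filter.atTop s := by
  intro u hu x hx
  exact ⟨_, self_mem_nhdsWithin, Filter.Eventually.of_forall fun _ _ _ => refl_mem_uniformity hu⟩

/-- The basic representation lemma for the infinite products. -/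
lemma jrep_product (c ε : ℚ) (hε : ‖(ε : ℂ)‖ = 1) (g : PowerSeries ℚ)
    (hg : ∀ N, trunc N g =
      trunc N (C c * (X : PowerSeries ℚ) * ∏ n ∈ range N, (1 + C ε * X ^ (n + 1)) ^ 24)) :
    JRep (g.map (algebraMap ℚ ℂ)) (fun q => c * q * (∏' n : ℕ, (1 + ε * q ^ (n + 1))) ^ 24) := by
  refine JRep.limit (F := fun N q => c * q * (∏ n ∈ range N, (1 + (ε : ℂ) * q ^ (n + 1))) ^ 24)
    (a := fun N => C (c : ℂ) * X * (∏ n ∈ range N, (1 + C (ε : ℂ) * X ^ (n + 1))) ^ 24) ?_ ?_ ?_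
  · exact (jconst_tendsto (fun q => (c : ℂ) * q) _).mul₀
      (jpow_tendsto (jprod_tendsto _ hε) (jprod_cont _ hε) 24) (by fun_prop)
      ((jprod_cont _ hε).pow 24)
  · intro N
    refine ((JRep.const _).mul JRep.var).mul ((JRep.prod (fun n => ?_) N).pow 24)
    exact (by simpa using JRep.const 1 : JRep 1 (fun _ => 1)).add
      ((JRep.const _).mul (JRep.var.pow _))
  · intro k
    filter_upwards [Filter.eventually_gt_atTop k] with N hN
    have h := congrArg (fun p => Polynomial.coeff p k) (hg N)
    simp only [coeff_trunc, hN, if_true] at h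
    rw [coeff_map, h, ← coeff_map]
    simp [Finset.prod_pow, map_mul, map_prod]


lemma jquot {R : Type*} [CommRing R] [Algebra ℚ R] (x g d e : R) (hx : x ^ 5 = 0)
    (hg : g = 64 * x * ∏ n ∈ range 5, (1 + x ^ (n + 1)) ^ 24)
    (hd : d = x * ∏ n ∈ range 5, (1 - x ^ (n + 1)) ^ 24)
    (he : e = 1 + 240 * x + 2160 * x ^ 2 + 6720 * x ^ 3 + 17520 * x ^ 4) :
    e ^ 3 * g - 64 * (1 + 4 * g) ^ 3 * d = 0 := by
  have key : ∀ y : R, y ^ 5 = 0 →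
      (1 + y) ^ 24 = 1 + 24 * y + 276 * y ^ 2 + 2024 * y ^ 3 + 10626 * y ^ 4 := by
    intro y hy
    have hk : ∀ k, 5 ≤ k → y ^ k = 0 := fun k h => pow_eq_zero_of_le h hy
    ring_nf
    simp [hk]
  have hk : ∀ k, 5 ≤ k → x ^ k = 0 := fun k h => pow_eq_zero_of_le h hx
  have p1 := key x hx
  have p2 := key (x ^ 2) (by rw [← pow_mul]; exact hk _ (by norm_num))
  have p3 := key (x ^ 3) (by rw [← pow_mul]; exact hk _ (by norm_num))
  have p4 := key (x ^ 4) (by rw [← pow_mul]; exact hk _ (by norm_num))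
  have m1 := key (-x) (by rw [neg_pow, hx, mul_zero])
  have m2 := key (-x ^ 2) (by rw [neg_pow, ← pow_mul, hk _ (by norm_num), mul_zero])
  have m3 := key (-x ^ 3) (by rw [neg_pow, ← pow_mul, hk _ (by norm_num), mul_zero])
  have m4 := key (-x ^ 4) (by rw [neg_pow, ← pow_mul, hk _ (by norm_num), mul_zero])
  have hg' : g = 64 * x * (1 + 24 * x + 300 * x ^ 2 + 2624 * x ^ 3) := by
    rw [hg]
    simp only [prod_range_succ, prod_range_zero, zero_add, Nat.reduceAdd, pow_one, one_mul, hx,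
      add_zero, one_pow, p1, p2, p3, p4]
    ring_nf
    simp [hk]
  have hd' : d = x * (1 - 24 * x + 252 * x ^ 2 - 1472 * x ^ 3) := by
    rw [hd]
    simp only [prod_range_succ, prod_range_zero, zero_add, Nat.reduceAdd, pow_one, one_mul, hx,
      sub_eq_add_neg, neg_zero, add_zero, one_pow, m1, m2, m3, m4]
    ring_nf
    simp [hk]
  rw [hg', hd', he]
  ring_nf
  simp [hk]

lemma jdvd (g Δ : PowerSeries ℚ)
    (hg : ∀ N, trunc N g =
      trunc N (64 * (X : PowerSeries ℚ) * ∏ n ∈ Finset.range N, (1 + X ^ (n + 1)) ^ 24))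
    (hΔ : ∀ N, trunc N Δ =
      trunc N ((X : PowerSeries ℚ) * ∏ n ∈ Finset.range N, (1 - X ^ (n + 1)) ^ 24)) :
    (X : PowerSeries ℚ) ^ 5 ∣ E4 ^ 3 * g - 64 * (1 + 4 * g) ^ 3 * Δ := by
  have tr : ∀ a b : PowerSeries ℚ, trunc 5 a = trunc 5 b → X ^ 5 ∣ a - b := by
    intro a b h
    rw [X_pow_dvd_iff]
    intro m hm
    have h := congrArg (fun p => Polynomial.coeff p m) h
    simp only [coeff_trunc, hm, if_true] at h
    simp [h]
  have hE : (X : PowerSeries ℚ) ^ 5 ∣ E4 -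
      (1 + 240 * X + 2160 * X ^ 2 + 6720 * X ^ 3 + 17520 * X ^ 4) := by
    rw [X_pow_dvd_iff]
    have c240 : (240 : PowerSeries ℚ) = C 240 := rfl
    have c2160 : (2160 : PowerSeries ℚ) = C 2160 := rfl
    have c6720 : (6720 : PowerSeries ℚ) = C 6720 := rfl
    have c17520 : (17520 : PowerSeries ℚ) = C 17520 := rfl
    have d2 : Nat.divisors 2 = {1, 2} := by decide
    have d3 : Nat.divisors 3 = {1, 3} := by decide
    have d4 : Nat.divisors 4 = {1, 2, 4} := by decide
    intro m hm
    rw [c240, c2160, c6720, c17520]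
    interval_cases m <;> simp [E4, coeff_X, coeff_X_pow, coeff_one, d2, d3, d4] <;> norm_num
  rw [← Ideal.mem_span_singleton, ← Ideal.Quotient.eq_zero_iff_mem]
  have q : ∀ a b : PowerSeries ℚ, X ^ 5 ∣ a - b →
      Ideal.Quotient.mk (Ideal.span {(X : PowerSeries ℚ) ^ 5}) a = Ideal.Quotient.mk _ b := by
    intro a b h
    rwa [Ideal.Quotient.eq, Ideal.mem_span_singleton]
  have hn : ∀ n : ℕ, Ideal.Quotient.mk (Ideal.span {(X : PowerSeries ℚ) ^ 5})
      (n : PowerSeries ℚ) = n := fun n => map_natCast _ n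
  have n4 := hn 4
  have n64 := hn 64
  have n240 := hn 240
  have n2160 := hn 2160
  have n6720 := hn 6720
  have n17520 := hn 17520
  push_cast at n4 n64 n240 n2160 n6720 n17520
  have h := jquot (Ideal.Quotient.mk (Ideal.span {(X : PowerSeries ℚ) ^ 5}) X)
    (Ideal.Quotient.mk _ g) (Ideal.Quotient.mk _ Δ) (Ideal.Quotient.mk _ E4)
    (by rw [← map_pow, Ideal.Quotient.eq_zero_iff_mem]; exact Ideal.mem_span_singleton_self _)
    (by rw [q _ _ (tr _ _ (hg 5))]; simp [n4, n64, n240, n2160, n6720, n17520]) (by rw [q _ _ (tr _ _ (hΔ 5))]; simp [n4, n64, n240, n2160, n6720, n17520])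
    (by rw [q _ _ hE]; simp [n4, n64, n240, n2160, n6720, n17520])
  simpa [n4, n64] using h


section JModular
open UpperHalfPlane Complex
open scoped MatrixGroups Real ModularForm

/-- The modular discriminant on complex numbers. -/
noncomputable def jD (z : ℂ) : ℂ := ModularForm.eta z ^ 24

lemma jD_eq_prod (z : ℂ) (hz : 0 < z.im) : jD z = cexp (2 * π * Complex.I * z) *
    (∏' n : ℕ, (1 + (-1) * cexp (2 * π * Complex.I * z) ^ (n + 1))) ^ 24 := by
  have h := ModularForm.discriminant_eq_q_prod ⟨z, hz⟩
  have h2 := (ModularForm.multipliableLocallyUniformlyOn_eta.multipliable hz).tprod_pow 24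
  change jD z = _ at h
  change _ = cexp _ * (∏' n : ℕ, _) ^ 24
  rw [h]
  simp only [] at h2 ⊢
  rw [h2]
  simp [ModularForm.eta_q, Function.Periodic.qParam, sub_eq_add_neg]

lemma jD_ne (z : ℂ) (hz : 0 < z.im) : jD z ≠ 0 := pow_ne_zero _ (ModularForm.eta_ne_zero hz)

lemma jD_diff (z : ℂ) (hz : 0 < z.im) : DifferentiableAt ℂ jD z :=
  (ModularForm.differentiableAt_eta_of_mem_upperHalfPlaneSet hz).pow 24

lemma jD_T (z : ℂ) (hz : 0 < z.im) : jD (z + 1) = jD z := by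
  rw [jD_eq_prod z hz, jD_eq_prod (z + 1) (by simpa using hz)]
  have : cexp (2 * π * Complex.I * (z + 1)) = cexp (2 * π * Complex.I * z) := by
    rw [mul_add, mul_one, Complex.exp_periodic]
  rw [this]

lemma jim_S (z : ℂ) (hz : 0 < z.im) : 0 < (-1 / z).im := by
  have := UpperHalfPlane.im_inv_neg_coe_pos ⟨z, hz⟩
  simpa [neg_div, inv_neg] using this

lemma jD_S (z : ℂ) (hz : 0 < z.im) : jD (-1 / z) = z ^ 12 * jD z := by
  have h := congrFun ModularForm.discriminant_S_invariant ⟨z, hz⟩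
  rw [ModularForm.SL_slash_apply, UpperHalfPlane.modular_S_smul, ModularGroup.denom_S] at h
  have hz0 : z ≠ 0 := by rintro rfl; simp at hz
  have h' : jD (-z)⁻¹ * (z ^ 12)⁻¹ = jD z := by
    rw [← zpow_natCast, ← zpow_neg]
    exact h
  rw [← h', neg_div, one_div, inv_neg]
  field_simp

lemma jD_half (z : ℂ) (hz : 0 < z.im) : jD ((-1 / z + 1) / 2) = z ^ 12 * jD ((z + 1) / 2) := by
  have hz0 : z ≠ 0 := by rintro rfl; simp at hz
  set v : ℂ := (z - 1) / 2 with hv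
  have hvi : 0 < v.im := by
    have : v.im = z.im / 2 := by simp [hv]
    rw [this]; positivity
  have hv0 : v ≠ 0 := by rintro h; rw [h] at hvi; simp at hvi
  have h1 := jD_S v hvi
  have hw := jim_S v hvi
  set w : ℂ := -1 / v with hw'
  have hw2 : 0 < (w - 2).im := by simpa using hw
  have h2 : jD w = jD (w - 2) := by
    rw [← jD_T (w - 2) hw2, ← jD_T (w - 2 + 1) (by simpa using hw)]
    congr 1; ring
  have h3 := jD_S _ hw2
  have hz1 : z - 1 ≠ 0 := by
    intro h; apply hv0; rw [hv, h]; simp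
  have e1 : w - 2 = -2 * z / (z - 1) := by
    rw [hw', hv]; field_simp; ring
  have e2 : -1 / (w - 2) = (-1 / z + 1) / 2 := by
    rw [e1]; field_simp; ring
  have e3 : jD ((z + 1) / 2) = jD v := by
    rw [← jD_T v hvi]; congr 1; rw [hv]; ring
  rw [← e2, h3, e3, ← h2, h1, e1, hv]
  field_simp

noncomputable def jx0 (z : ℂ) : ℂ := 4096 * jD (2 * z) / jD z
noncomputable def jx1 (z : ℂ) : ℂ := jD (z / 2) / jD z
noncomputable def jx2 (z : ℂ) : ℂ := jD ((z + 1) / 2) / jD z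

lemma jim_two (z : ℂ) (hz : 0 < z.im) : 0 < (2 * z).im := by simpa using hz
lemma jim_half (z : ℂ) (hz : 0 < z.im) : 0 < (z / 2).im := by simpa using hz
lemma jim_half1 (z : ℂ) (hz : 0 < z.im) : 0 < ((z + 1) / 2).im := by simpa using hz

lemma jx0_T (z : ℂ) (hz : 0 < z.im) : jx0 (z + 1) = jx0 z := by
  have h : jD (2 * (z + 1)) = jD (2 * z) := by
    rw [← jD_T (2 * z) (jim_two z hz), ← jD_T (2 * z + 1) (by simpa using hz)]
    congr 1; ring
  rw [jx0, jx0, jD_T z hz, h]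

lemma jx1_T (z : ℂ) (hz : 0 < z.im) : jx1 (z + 1) = jx2 z := by
  rw [jx1, jx2, jD_T z hz]

lemma jx2_T (z : ℂ) (hz : 0 < z.im) : jx2 (z + 1) = jx1 z := by
  rw [jx1, jx2, jD_T z hz, ← jD_T (z / 2) (jim_half z hz)]
  congr 2; ring

lemma jx0_S (z : ℂ) (hz : 0 < z.im) : jx0 (-1 / z) = jx1 z := by
  have hz0 : z ≠ 0 := by rintro rfl; simp at hz
  have hn := jD_ne z hz
  have h : jD (2 * (-1 / z)) = (z / 2) ^ 12 * jD (z / 2) := by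
    rw [← jD_S _ (jim_half z hz)]; congr 1; field_simp
  rw [jx0, jx1, jD_S z hz, h]
  field_simp; norm_num

lemma jx1_S (z : ℂ) (hz : 0 < z.im) : jx1 (-1 / z) = jx0 z := by
  have hz0 : z ≠ 0 := by rintro rfl; simp at hz
  have hn := jD_ne z hz
  have h : jD (-1 / z / 2) = (2 * z) ^ 12 * jD (2 * z) := by
    rw [← jD_S _ (jim_two z hz)]; congr 1; field_simp
  rw [jx0, jx1, jD_S z hz, h]
  field_simp; ring

lemma jx2_S (z : ℂ) (hz : 0 < z.im) : jx2 (-1 / z) = jx2 z := by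
  have hz0 : z ≠ 0 := by rintro rfl; simp at hz
  have hn := jD_ne z hz
  rw [jx2, jx2, jD_S z hz, jD_half z hz]
  field_simp

/-- The `j`-function. -/
noncomputable def jJ (z : ℂ) : ℂ := ModularForm.E₄ (ofComplex z) ^ 3 / jD z

lemma jE_T (τ : ℍ) : ModularForm.E₄ (ModularGroup.T • τ) = ModularForm.E₄ τ := by
  have h := ModularForm.E₄.slash_action_eq' _ ⟨ModularGroup.T, rfl⟩
  have h := congrFun h τ
  change ((ModularForm.E₄ : ℍ → ℂ) ∣[(4 : ℤ)] ModularGroup.T) τ = ModularForm.E₄ τ at h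
  have hd : denom ModularGroup.T τ = 1 := by rw [ModularGroup.denom_apply]; simp [ModularGroup.T]
  rw [ModularForm.SL_slash_apply, hd, one_zpow, mul_one] at h
  exact h

lemma jE_S (τ : ℍ) : ModularForm.E₄ (ModularGroup.S • τ) = τ ^ 4 * ModularForm.E₄ τ := by
  have h := ModularForm.E₄.slash_action_eq' _ ⟨ModularGroup.S, rfl⟩
  have h := congrFun h τ
  change ((ModularForm.E₄ : ℍ → ℂ) ∣[(4 : ℤ)] ModularGroup.S) τ = ModularForm.E₄ τ at h
  rw [ModularForm.SL_slash_apply, ModularGroup.denom_S] at h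
  have h' : ModularForm.E₄ (ModularGroup.S • τ) * ((τ : ℂ) ^ 4)⁻¹ = ModularForm.E₄ τ := by
    rw [← zpow_natCast, ← zpow_neg]
    exact h
  have := τ.ne_zero
  rw [← h']; field_simp

lemma jS_coe (τ : ℍ) : ((ModularGroup.S • τ : ℍ) : ℂ) = -1 / τ := by
  rw [UpperHalfPlane.modular_S_smul]; simp [neg_div, inv_neg]

lemma jT_coe (τ : ℍ) : ((ModularGroup.T • τ : ℍ) : ℂ) = τ + 1 := by
  rw [UpperHalfPlane.modular_T_smul]; simp [add_comm]

lemma jJ_T (τ : ℍ) : jJ (τ + 1) = jJ τ := by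
  rw [← jT_coe, jJ, jJ, ofComplex_apply, ofComplex_apply, jE_T, jT_coe, jD_T _ τ.2]

lemma jJ_S (τ : ℍ) : jJ (-1 / τ) = jJ τ := by
  have := τ.ne_zero
  have hn := jD_ne τ τ.2
  rw [← jS_coe, jJ, jJ, ofComplex_apply, ofComplex_apply, jE_S, jS_coe, jD_S _ τ.2]
  field_simp

noncomputable def ju (x : ℂ → ℂ) (z : ℂ) : ℂ := jJ z * x z - (x z + 16) ^ 3

noncomputable def jU (τ : ℍ) : ℂ := ju jx0 τ * (ju jx1 τ * ju jx2 τ)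

lemma jU_T (τ : ℍ) : jU (ModularGroup.T • τ) = jU τ := by
  have h := τ.2
  simp only [jU, ju, jT_coe, jJ_T, jx0_T _ h, jx1_T _ h, jx2_T _ h]
  ring

lemma jU_S (τ : ℍ) : jU (ModularGroup.S • τ) = jU τ := by
  have h := τ.2
  simp only [jU, ju, jS_coe, jJ_S, jx0_S _ h, jx1_S _ h, jx2_S _ h]
  ring

lemma jJ_diff (z : ℂ) (hz : 0 < z.im) : DifferentiableAt ℂ jJ z := by
  have h := UpperHalfPlane.mdifferentiable_iff.1 ModularForm.E₄.holo'
  have h' := (h z hz).differentiableAt (isOpen_upperHalfPlaneSet.mem_nhds hz)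
  exact (h'.pow 3).div (jD_diff z hz) (jD_ne z hz)

lemma jx0_diff (z : ℂ) (hz : 0 < z.im) : DifferentiableAt ℂ jx0 z := by
  have h : DifferentiableAt ℂ (fun z => jD (2 * z)) z :=
    DifferentiableAt.comp z (g := jD) (f := fun z => 2 * z) (jD_diff (2 * z) (jim_two z hz)) (by fun_prop)
  exact (h.const_mul 4096).div (jD_diff z hz) (jD_ne z hz)

lemma jx1_diff (z : ℂ) (hz : 0 < z.im) : DifferentiableAt ℂ jx1 z := by
  have h : DifferentiableAt ℂ (fun z => jD (z / 2)) z :=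
    DifferentiableAt.comp z (g := jD) (f := fun z => z / 2) (jD_diff (z / 2) (jim_half z hz)) (by fun_prop)
  exact h.div (jD_diff z hz) (jD_ne z hz)

lemma jx2_diff (z : ℂ) (hz : 0 < z.im) : DifferentiableAt ℂ jx2 z := by
  have h : DifferentiableAt ℂ (fun z => jD ((z + 1) / 2)) z :=
    DifferentiableAt.comp z (g := jD) (f := fun z => (z + 1) / 2) (jD_diff ((z + 1) / 2) (jim_half1 z hz)) (by fun_prop)
  exact h.div (jD_diff z hz) (jD_ne z hz)

lemma ju_diff {x : ℂ → ℂ} (z : ℂ) (hz : 0 < z.im) (hx : DifferentiableAt ℂ x z) :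
    DifferentiableAt ℂ (ju x) z :=
  ((jJ_diff z hz).mul hx).sub ((hx.add_const 16).pow 3)

lemma jU_const (h0 : Filter.Tendsto jU atImInfty (nhds 0)) : ∀ τ, jU τ = 0 := by
  have hS : jU ∣[(0 : ℤ)] ModularGroup.S = jU := by
    ext τ; rw [ModularForm.SL_slash_apply]; simpa using jU_S τ
  have hT : jU ∣[(0 : ℤ)] ModularGroup.T = jU := by
    ext τ; rw [ModularForm.SL_slash_apply]; simpa using jU_T τ
  let f : CuspForm 𝒮ℒ 0 :=
    { toFun := jU
      slash_action_eq' := by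
        intro A hA
        obtain ⟨A, rfl⟩ := hA
        exact SlashInvariantForm.slash_action_generators_SL2Z hS hT A
      holo' := by
        rw [UpperHalfPlane.mdifferentiable_iff]
        refine DifferentiableOn.congr (f := fun z => ju jx0 z * (ju jx1 z * ju jx2 z))
          (fun z hz ↦ ?_) fun z hz ↦ ?_
        · have hz : 0 < z.im := hz
          exact ((ju_diff z hz (jx0_diff z hz)).mul ((ju_diff z hz (jx1_diff z hz)).mul
            (ju_diff z hz (jx2_diff z hz)))).differentiableWithinAt
        · simp [jU, ofComplex_apply_of_im_pos hz]
      zero_at_cusps' := by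
        intro c hc
        rw [Subgroup.IsArithmetic.isCusp_iff_isCusp_SL2Z] at hc
        rw [OnePoint.isZeroAt_iff_forall_SL2Z hc]
        intro γ _
        rw [SlashInvariantForm.slash_action_generators_SL2Z hS hT]
        exact h0 }
  obtain ⟨c, hc⟩ := ModularFormClass.levelOne_weight_zero_const f
  have hc' : jU = Function.const _ c := hc
  rw [hc'] at h0
  have : c = 0 := tendsto_nhds_unique tendsto_const_nhds h0
  intro τ
  rw [hc', this]; rfl

lemma ju0_zero (h0 : Filter.Tendsto jU atImInfty (nhds 0)) :
    ∀ z : ℂ, 0 < z.im → ju jx0 z = 0 := by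
  have hU : ∀ z ∈ upperHalfPlaneSet, ju jx0 z * (ju jx1 z * ju jx2 z) = 0 := fun z hz =>
    jU_const h0 ⟨z, hz⟩
  have hc : IsPreconnected upperHalfPlaneSet := (convex_halfSpace_im_gt 0).isPreconnected
  have an : ∀ x : ℂ → ℂ, (∀ z : ℂ, 0 < z.im → DifferentiableAt ℂ x z) →
      AnalyticOnNhd ℂ (ju x) upperHalfPlaneSet := fun x hx =>
    DifferentiableOn.analyticOnNhd
      (fun z hz => (ju_diff z hz (hx z hz)).differentiableWithinAt) isOpen_upperHalfPlaneSet
  have a0 := an _ jx0_diff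
  have a1 := an _ jx1_diff
  have a2 := an _ jx2_diff
  have u1 : (∀ z ∈ upperHalfPlaneSet, ju jx1 z = 0) → ∀ z : ℂ, 0 < z.im → ju jx0 z = 0 := by
    intro h z hz
    have := h _ (jim_S z hz)
    have hj := jJ_S ⟨z, hz⟩
    simp only [ju, jx1_S z hz] at this ⊢
    rw [← this, ← hj]
  rcases AnalyticOnNhd.eq_zero_or_eq_zero_of_mul_eq_zero a0 (a1.mul a2) hU hc with h | h
  · exact h
  · rcases AnalyticOnNhd.eq_zero_or_eq_zero_of_mul_eq_zero a1 a2 h hc with h | h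
    · exact u1 h
    · apply u1
      intro z hz
      have hz1 : 0 < (z + 1).im := by simpa using hz
      have := h (z + 1) hz1
      have hj := jJ_T ⟨z, hz⟩
      simp only [ju, jx2_T z hz] at this ⊢
      rw [← this, ← hj]

end JModular

lemma JRep.divX {r : PowerSeries ℂ} {F : ℂ → ℂ} (h : JRep (X * r) F) :
    JRep r (fun q => if q = 0 then coeff 0 r else F q / q) := by
  intro q hq
  by_cases h0 : q = 0
  · subst h0
    have := hasSum_single (f := fun n => coeff n r * (0:ℂ) ^ n) 0
      (by intro n hn; simp [hn])
    simpa using this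
  · have h1 := (hasSum_nat_add_iff' (f := fun n => coeff n (X * r) * q ^ n) 1).2 (h q hq)
    have h2 := h1.mul_right q⁻¹
    simp only [h0, if_false]
    have e1 : (fun n => coeff n r * q ^ n) =
        fun n => coeff (n + 1) (X * r) * q ^ (n + 1) * q⁻¹ := by
      funext n
      rw [coeff_succ_X_mul, pow_succ]
      field_simp
    have e2 : F q / q = (F q - ∑ i ∈ range 1, coeff i (X * r) * q ^ i) * q⁻¹ := by
      rw [sum_range_one, coeff_zero_X_mul, zero_mul, sub_zero, div_eq_mul_inv]
    rw [e1, e2]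
    exact h2

lemma JRep.divXpow (k : ℕ) : ∀ {r : PowerSeries ℂ} {F : ℂ → ℂ}, JRep (X ^ k * r) F →
    ∃ R : ℂ → ℂ, JRep r R ∧ ∀ q, ‖q‖ < 1 → q ≠ 0 → F q = q ^ k * R q := by
  induction k with
  | zero => intro r F h; exact ⟨F, by simpa using h, by simp⟩
  | succ k ih =>
    intro r F h
    rw [pow_succ', mul_assoc] at h
    obtain ⟨R, hR, h2⟩ := ih h.divX
    refine ⟨R, hR, fun q hq h0 => ?_⟩
    have := h2 q hq h0
    simp only [h0, if_false] at this
    rw [pow_succ', mul_assoc, ← this]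
    field_simp

lemma JRep.continuousAt {a : PowerSeries ℂ} {F : ℂ → ℂ} (h : JRep a F) : ContinuousAt F 0 :=
  h.hasFPowerSeries.analyticAt.continuousAt

/-- The Euler product. -/
noncomputable def jP (ε q : ℂ) : ℂ := ∏' n : ℕ, (1 + ε * q ^ (n + 1))

lemma jP_continuousAt (ε : ℂ) (hε : ‖ε‖ = 1) : ContinuousAt (jP ε) 0 :=
  (jprod_cont ε hε).continuousAt (Metric.ball_mem_nhds _ one_pos)

lemma jP_zero (ε : ℂ) : jP ε 0 = 1 := by simp [jP]

lemma jP_mult (ε : ℂ) (hε : ‖ε‖ = 1) (q : ℂ) (hq : ‖q‖ < 1) :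
    Multipliable fun n : ℕ => 1 + ε * q ^ (n + 1) := by
  apply multipliable_one_add_of_summable
  simpa [hε] using (summable_nat_add_iff 1).2 (summable_geometric_of_lt_one (norm_nonneg q) hq)

lemma jP_sq (q : ℂ) (hq : ‖q‖ < 1) : jP (-1) (q ^ 2) = jP 1 q * jP (-1) q := by
  rw [jP, jP, jP, ← (jP_mult 1 (by simp) q hq).tprod_mul (jP_mult (-1) (by simp) q hq)]
  refine tprod_congr fun n => ?_
  ring

/-- Values of `E₄` as a function on the disc. -/
noncomputable def jFE (q : ℂ) : ℂ := UpperHalfPlane.cuspFunction 1 ModularForm.E₄ q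

lemma jcoef (n : ℕ) (q : ℂ) : coeff n (E4.map (algebraMap ℚ ℂ)) * q ^ n =
    coeff n (UpperHalfPlane.qExpansion 1 ModularForm.E₄) • q ^ n := by
  rw [EisensteinSeries.E_qExpansion_coeff _ (by decide), smul_eq_mul]
  congr 1
  have hb : bernoulli 4 = -1 / 30 := by
    rw [bernoulli_eq_bernoulli'_of_ne_one (by norm_num), bernoulli'_four]
  rw [hb, coeff_map, E4, coeff_mk, ArithmeticFunction.sigma_apply]
  by_cases hn : n = 0
  · simp [hn]
  · simp [hn]
    norm_num

lemma jFE_rep : JRep (E4.map (algebraMap ℚ ℂ)) jFE := by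
  intro q hq
  have h := UpperHalfPlane.hasSum_qExpansion_of_norm_lt (h := 1) (f := ModularForm.E₄) one_pos
    (SlashInvariantFormClass.periodic_comp_ofComplex _ one_mem_strictPeriods_SL)
    ModularForm.E₄.holo' (ModularFormClass.bdd_at_infty _) hq
  change HasSum _ (UpperHalfPlane.cuspFunction 1 ModularForm.E₄ q)
  have he : (fun n => coeff n (E4.map (algebraMap ℚ ℂ)) * q ^ n) =
      fun n => coeff n (UpperHalfPlane.qExpansion 1 ModularForm.E₄) • q ^ n := by
    funext n
    exact jcoef n q
  rw [he]
  exact h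

lemma jFE_eq (τ : UpperHalfPlane) : jFE (Function.Periodic.qParam 1 τ) = ModularForm.E₄ τ :=
  SlashInvariantFormClass.eq_cuspFunction _ τ one_mem_strictPeriods_SL one_ne_zero

/-- The nome. -/
noncomputable def jq (z : ℂ) : ℂ := Function.Periodic.qParam 1 z

lemma jq_eq (z : ℂ) : jq z = Complex.exp (2 * Real.pi * Complex.I * z) := by
  simp [jq, Function.Periodic.qParam]

lemma jq_lt (z : ℂ) (hz : 0 < z.im) : ‖jq z‖ < 1 := by
  have := UpperHalfPlane.norm_qParam_lt_one 1 ⟨z, hz⟩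
  simpa [jq] using this

lemma jq_ne (z : ℂ) : jq z ≠ 0 := by rw [jq_eq]; exact Complex.exp_ne_zero _

lemma jq_two (z : ℂ) : jq (2 * z) = jq z ^ 2 := by
  rw [jq_eq, jq_eq, ← Complex.exp_nat_mul]; congr 1; push_cast; ring

lemma jq_half (z : ℂ) : jq z = jq (z / 2) ^ 2 := by
  rw [← jq_two]; congr 1; ring

lemma jq_half1 (z : ℂ) : jq ((z + 1) / 2) = -jq (z / 2) := by
  rw [jq_eq, jq_eq]
  have : 2 * (Real.pi : ℂ) * Complex.I * ((z + 1) / 2) =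
    2 * Real.pi * Complex.I * (z / 2) + Real.pi * Complex.I := by ring
  rw [this, Complex.exp_add, Complex.exp_pi_mul_I]; ring

lemma jD_eq (z : ℂ) (hz : 0 < z.im) : jD z = jq z * jP (-1) (jq z) ^ 24 := by
  rw [jD_eq_prod z hz, jq_eq, jP]

lemma jP_ne (z : ℂ) (hz : 0 < z.im) : jP (-1) (jq z) ≠ 0 := by
  intro h
  apply jD_ne z hz
  rw [jD_eq z hz, h]; simp

lemma jJ_eq (z : ℂ) (hz : 0 < z.im) : jJ z = jFE (jq z) ^ 3 / jD z := by
  rw [jJ, UpperHalfPlane.ofComplex_apply_of_im_pos hz, ← jFE_eq]; rfl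

/-- The function `g` on the disc. -/
noncomputable def jG (q : ℂ) : ℂ := 64 * q * jP 1 q ^ 24

/-- The function `W` on the disc. -/
noncomputable def jW (q : ℂ) : ℂ :=
  jFE q ^ 3 * jG q - 64 * (1 + 4 * jG q) ^ 3 * (1 * q * jP (-1) q ^ 24)

lemma ju0_eq (z : ℂ) (hz : 0 < z.im) : ju jx0 z = 64 * jW (jq z) / jD z := by
  have hn := jP_ne z hz
  have hq := jq_ne z
  have hx : jx0 z = 64 * jG (jq z) := by
    rw [jx0, jD_eq z hz, jD_eq _ (jim_two z hz), jq_two, jP_sq _ (jq_lt z hz), jG]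
    field_simp; ring
  have hD := jD_ne z hz
  rw [ju, hx, jJ_eq z hz, jW, one_mul, ← jD_eq z hz]
  field_simp; ring

lemma jtendsto (R : ℂ → ℂ) (hc : ContinuousAt R 0)
    (hR : ∀ q, ‖q‖ < 1 → q ≠ 0 → jW q = q ^ 5 * R q) :
    Filter.Tendsto jU UpperHalfPlane.atImInfty (nhds 0) := by
  let A : ℂ → ℂ := fun Q => jFE (Q ^ 2) ^ 3 / jP (-1) (Q ^ 2) ^ 24 *
    (jP (-1) Q ^ 24 / jP (-1) (Q ^ 2) ^ 24) -
    (jP (-1) Q ^ 24 / jP (-1) (Q ^ 2) ^ 24 + 16 * Q) ^ 3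
  let B : ℂ → ℂ := fun Q => jFE (Q ^ 2) ^ 3 / jP (-1) (Q ^ 2) ^ 24 *
    (- jP (-1) (-Q) ^ 24 / jP (-1) (Q ^ 2) ^ 24) -
    (- jP (-1) (-Q) ^ 24 / jP (-1) (Q ^ 2) ^ 24 + 16 * Q) ^ 3
  let Φ : ℂ → ℂ := fun Q => Q ^ 2 * (64 * R (Q ^ 2) / jP (-1) (Q ^ 2) ^ 24) * (A Q * B Q)
  have hP := jP_continuousAt (-1) (by simp)
  have sq : ContinuousAt (fun Q : ℂ => Q ^ 2) 0 := by fun_prop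
  have ng : ContinuousAt (fun Q : ℂ => -Q) 0 := by fun_prop
  have cP2 : ContinuousAt (fun Q : ℂ => jP (-1) (Q ^ 2)) 0 :=
    ContinuousAt.comp' (g := jP (-1)) (by simpa using hP) sq
  have cPn : ContinuousAt (fun Q : ℂ => jP (-1) (-Q)) 0 :=
    ContinuousAt.comp' (g := jP (-1)) (by simpa using hP) ng
  have cE : ContinuousAt (fun Q : ℂ => jFE (Q ^ 2)) 0 :=
    ContinuousAt.comp' (g := jFE) (by simpa using jFE_rep.continuousAt) sq
  have cR : ContinuousAt (fun Q : ℂ => R (Q ^ 2)) 0 :=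
    ContinuousAt.comp' (g := R) (by simpa using hc) sq
  have n0 : jP (-1) ((0 : ℂ) ^ 2) ^ 24 ≠ 0 := by simp [jP_zero]
  have cA : ContinuousAt A 0 :=
    (((cE.pow 3).div (cP2.pow 24) n0).mul ((hP.pow 24).div (cP2.pow 24) n0)).sub
      ((((hP.pow 24).div (cP2.pow 24) n0).add (by fun_prop)).pow 3)
  have cB : ContinuousAt B 0 :=
    (((cE.pow 3).div (cP2.pow 24) n0).mul ((cPn.pow 24).neg.div (cP2.pow 24) n0)).sub
      ((((cPn.pow 24).neg.div (cP2.pow 24) n0).add (by fun_prop)).pow 3)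
  have cΦ : ContinuousAt Φ 0 :=
    (sq.mul ((cR.const_mul 64).div (cP2.pow 24) n0)).mul (cA.mul cB)
  have hΦ : Filter.Tendsto Φ (nhds 0) (nhds 0) := by
    have := cΦ.tendsto
    simpa [Φ] using this
  have hQ := UpperHalfPlane.qParam_tendsto_atImInfty (h := 2) two_pos
  refine (hΦ.comp hQ).congr fun τ => ?_
  have hz : 0 < (τ : ℂ).im := τ.2
  have e : Function.Periodic.qParam 2 (τ : ℂ) = jq ((τ : ℂ) / 2) := by
    rw [jq_eq, Function.Periodic.qParam]; congr 1; push_cast; ring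
  have d1 := jD_eq _ (jim_half _ hz)
  have d2 := jD_eq _ (jim_half1 _ hz)
  have d := jD_eq _ hz
  have hn := jP_ne _ hz
  have hw := hR _ (jq_lt _ hz) (jq_ne _)
  have hq := jq_ne ((τ : ℂ) / 2)
  have hJ := jJ_eq _ hz
  have h0 := ju0_eq _ hz
  rw [hw, d] at h0
  rw [d] at hJ
  rw [jq_half1] at d2
  rw [jq_half] at d hn hJ h0
  simp only [Function.comp, e]
  generalize jq ((τ : ℂ) / 2) = Q at *
  have h1 : ju jx1 τ = A Q / Q ^ 3 := by
    simp only [ju, jx1, hJ, d, d1, A]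
    field_simp
  have h2 : ju jx2 τ = B Q / Q ^ 3 := by
    simp only [ju, jx2, hJ, d, d2, B]
    field_simp
  rw [jU, h0, h1, h2]
  simp only [Φ]
  field_simp

lemma jmain (g Δ : PowerSeries ℚ)
    (hg : ∀ N, trunc N g =
      trunc N (64 * (X : PowerSeries ℚ) * ∏ n ∈ Finset.range N, (1 + X ^ (n + 1)) ^ 24))
    (hΔ : ∀ N, trunc N Δ =
      trunc N ((X : PowerSeries ℚ) * ∏ n ∈ Finset.range N, (1 - X ^ (n + 1)) ^ 24)) :
    E4 ^ 3 * g = 64 * (1 + 4 * g) ^ 3 * Δ := by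
  obtain ⟨r, hr⟩ := jdvd g Δ hg hΔ
  have rg := jrep_product 64 1 (by simp) g (by
    intro N
    have c : (C 64 : PowerSeries ℚ) = 64 := rfl
    rw [hg N, c]; simp)
  have rΔ := jrep_product 1 (-1) (by simp) Δ (by
    intro N
    rw [hΔ N]; simp [sub_eq_add_neg])
  have hW : JRep ((E4 ^ 3 * g - 64 * (1 + 4 * g) ^ 3 * Δ).map (algebraMap ℚ ℂ)) jW := by
    have h := ((jFE_rep.pow 3).mul rg).sub (((JRep.const 64).mul
      (((JRep.const 1).add ((JRep.const 4).mul rg)).pow 3)).mul rΔ)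
    have c64 : (C 64 : PowerSeries ℂ) = 64 := rfl
    have c4 : (C 4 : PowerSeries ℂ) = 4 := rfl
    convert h using 1
    · have m64 : (64 : PowerSeries ℚ).map (algebraMap ℚ ℂ) = 64 := map_ofNat _ 64
      have m4 : (4 : PowerSeries ℚ).map (algebraMap ℚ ℂ) = 4 := map_ofNat _ 4
      rw [c64, c4]
      simp only [map_sub, map_mul, map_pow, map_add, map_one, m64, m4]
    · funext q
      simp [jW, jG, jP]
  have hW' := hW
  rw [hr, map_mul, map_pow, map_X] at hW'
  obtain ⟨R, hR, hRW⟩ := hW'.divXpow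
  have hu := ju0_zero (jtendsto R hR.continuousAt hRW)
  have hz : ∀ q : ℂ, ‖q‖ < 1 → q * jW q = 0 := by
    intro q hq
    by_cases h0 : q = 0
    · simp [h0]
    · have hi := Function.Periodic.im_invQParam_pos_of_norm_lt_one one_pos hq h0
      have h1 := hu _ hi
      rw [ju0_eq _ hi, jq, Function.Periodic.qParam_right_inv one_ne_zero h0, div_eq_zero_iff] at h1
      have := jD_ne _ hi
      simp_all
  have h := (JRep.var.mul hW).eq_zero hz
  have h2 := (mul_eq_zero.1 h).resolve_left X_ne_zero
  rw [← sub_eq_zero]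
  exact (map_eq_zero_iff _ (PowerSeries.map_injective _ (algebraMap ℚ ℂ).injective)).1 h2

/-- With `g = 64·q·∏(1+qⁿ)^24`, `Δ = q·∏(1-qⁿ)^24` and `j = E₄³/Δ`, one has
`j·g = 64·(1+4g)³`; since `j` is a Laurent series with simple pole, this is stated
as the power series identity `E₄³·g = 64·(1+4g)³·Δ` in `ℚ[[q]]`. -/
theorem j_g_identity (g Δ : PowerSeries ℚ)
    (hg : ∀ N, trunc N g =
      trunc N (64 * (X : PowerSeries ℚ) * ∏ n ∈ Finset.range N, (1 + X ^ (n + 1)) ^ 24))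
    (hΔ : ∀ N, trunc N Δ =
      trunc N ((X : PowerSeries ℚ) * ∏ n ∈ Finset.range N, (1 - X ^ (n + 1)) ^ 24)) :
    E4 ^ 3 * g = 64 * (1 + 4 * g) ^ 3 * Δ := by
  exact jmain g Δ hg hΔ
end
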